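/- arXiv:math/0309235 — 3 statements merged into one kernel-verified Lean document; each statement's English description precedes it below -/
import Mathlib

section
/- Let S be a countable set and π : S → (0,∞). Then ∑_{x∈S} π(x)/(1+π(x))² = ∞ if and only if the measures {ν^c : 0 ≤ c ≤ ∞} are pairwise mutually singular, i.e. for all c, c' ∈ [0,∞] with c ≠ c', the measures ν^c and ν^{c'} are mutually singular. -/
open MeasureTheory Filter Topology

section Defs

variable {S : Type*}

/-- The configuration obtained from `η` by exchanging the values at sites `x` and `y`. -/
def swapConfig [DecidableEq S] (x y : S) (η : S → Bool) : S → Bool :=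
  fun u => if u = x then η y else if u = y then η x else η u

/-- A cylinder function depends on finitely many coordinates. -/
def IsCylinder (f : (S → Bool) → ℝ) : Prop :=
  ∃ F : Finset S, ∀ η ξ : S → Bool, (∀ x ∈ F, η x = ξ x) → f η = f ξ

/-- The exclusion process generator applied to a cylinder function. -/
noncomputable def exclGen [DecidableEq S] (p : S → S → ℝ) (f : (S → Bool) → ℝ)
    (η : S → Bool) : ℝ :=
  ∑' x : S, ∑' y : S,
    (if η x = true ∧ η y = false then p x y * (f (swapConfig x y η) - f η) else 0)

/-- `p` is a transition probability function with bounded column sums. -/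
def IsTransition (p : S → S → ℝ) : Prop :=
  (∀ x y, 0 ≤ p x y) ∧ (∀ x, HasSum (fun y => p x y) 1) ∧
    ∃ C : ℝ, ∀ (y : S) (F : Finset S), ∑ x ∈ F, p x y ≤ C

/-- A probability measure is invariant for the exclusion process. -/
def ExclInvariant [DecidableEq S] (p : S → S → ℝ) (μ : Measure (S → Bool)) : Prop :=
  IsProbabilityMeasure μ ∧ ∀ f : (S → Bool) → ℝ, IsCylinder f → ∫ η, exclGen p f η ∂μ = 0

/-- Extremal invariant probability measures. -/
def IsExtremalInvariant [DecidableEq S] (p : S → S → ℝ) (μ : Measure (S → Bool)) : Prop :=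
  ExclInvariant p μ ∧ ∀ (t : ℝ) (ν₁ ν₂ : Measure (S → Bool)), 0 < t → t < 1 →
    ExclInvariant p ν₁ → ExclInvariant p ν₂ →
    μ = ENNReal.ofReal t • ν₁ + ENNReal.ofReal (1 - t) • ν₂ → ν₁ = μ ∧ ν₂ = μ

/-- A reversible measure `π` for the kernel `p`. -/
def IsReversible (p : S → S → ℝ) (π : S → ℝ) : Prop :=
  (∀ x, 0 < π x) ∧ ∀ x y, π x * p x y = π y * p y x

/-- Irreducibility of `p`. -/
def IrreducibleKernel (p : S → S → ℝ) : Prop :=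
  ∀ x y : S, x ≠ y → ∃ (n : ℕ) (c : ℕ → S), c 0 = x ∧ c n = y ∧ ∀ i < n, 0 < p (c i) (c (i+1))

/-- `ν` is the product (Bernoulli) measure with marginals `α`. -/
def IsBernoulliProduct (ν : Measure (S → Bool)) (α : S → ℝ) : Prop :=
  IsProbabilityMeasure ν ∧ ∀ (F : Finset S) (a : S → Bool),
    ν {η | ∀ x ∈ F, η x = a x} = ∏ x ∈ F, ENNReal.ofReal (if a x then α x else 1 - α x)

/-- A probability measure is reversible for the exclusion process. -/
def IsReversibleMeasure [DecidableEq S] (p : S → S → ℝ) (μ : Measure (S → Bool)) : Prop :=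
  ∀ f g : (S → Bool) → ℝ, IsCylinder f → IsCylinder g →
    ∫ η, f η * exclGen p g η ∂μ = ∫ η, g η * exclGen p f η ∂μ

end Defs

/-- The mass given to `b` by the Bernoulli law with success probability `r`. -/
noncomputable def bernoulliWeight (r : ℝ) (b : Bool) : ℝ := if b then r else 1 - r

lemma bernoulliWeight_nonneg {r : ℝ} (h0 : 0 ≤ r) (h1 : r ≤ 1) (b : Bool) :
    0 ≤ bernoulliWeight r b := by
  unfold bernoulliWeight
  split_ifs <;> linarith

lemma measurableSet_forall_mem_eq {S : Type*} (F : Finset S) (a : S → Bool) :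
    MeasurableSet {η : S → Bool | ∀ x ∈ F, η x = a x} := by
  have : {η : S → Bool | ∀ x ∈ F, η x = a x} = ⋂ x ∈ F, (fun η => η x) ⁻¹' {a x} := by
    ext; simp
  rw [this]
  exact F.measurableSet_biInter fun x _ => measurable_pi_apply x (measurableSet_singleton _)

namespace IsBernoulliProduct

variable {S : Type*} {μ ν : Measure (S → Bool)} {α β : S → ℝ}

lemma measure_restrict_preimage_singleton (h : IsBernoulliProduct μ α) (h0 : ∀ x, 0 ≤ α x)
    (h1 : ∀ x, α x ≤ 1) (F : Finset S) (a : F → Bool) :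
    μ (F.restrict ⁻¹' {a}) = ENNReal.ofReal (∏ x : F, bernoulliWeight (α x) (a x)) := by
  classical
  have key := h.2 F (fun x => if hx : x ∈ F then a ⟨x, hx⟩ else false)
  rw [← Finset.prod_coe_sort] at key
  rw [ENNReal.ofReal_prod_of_nonneg fun (x : F) _ => bernoulliWeight_nonneg (h0 x) (h1 x) (a x)]
  convert! key using 1
  · congr 1
    ext η
    simp only [Set.mem_preimage, Set.mem_singleton_iff, funext_iff, Finset.restrict,
      Subtype.forall, Set.mem_ofPred_eq]
    exact forall₂_congr fun x hx => by simp [hx]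
  · refine Finset.prod_congr rfl fun x _ => ?_
    simp [bernoulliWeight]

/-- An event depending on the coordinates in `F` on which `μ` is less likely than `ν` has
`μ`-mass at most the Hellinger affinity of the two laws restricted to `F`. -/
lemma measure_restrict_preimage_le (h : IsBernoulliProduct μ α)
    (hα0 : ∀ x, 0 ≤ α x) (hα1 : ∀ x, α x ≤ 1) (hβ0 : ∀ x, 0 ≤ β x) (hβ1 : ∀ x, β x ≤ 1)
    (F : Finset S) (A : Finset (F → Bool))
    (hA : ∀ a ∈ A, ∏ x : F, bernoulliWeight (α x) (a x) ≤ ∏ x : F, bernoulliWeight (β x) (a x)) :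
    μ (F.restrict ⁻¹' A) ≤
      ENNReal.ofReal (∏ x ∈ F, (√(α x * β x) + √((1 - α x) * (1 - β x)))) := by
  classical
  have wα (x) (b) := bernoulliWeight_nonneg (hα0 x) (hα1 x) b
  have wβ (x) (b) := bernoulliWeight_nonneg (hβ0 x) (hβ1 x) b
  have hm : Measurable (F.restrict : (S → Bool) → (F → Bool)) := by fun_prop
  have hexp : ∏ x ∈ F, (√(α x * β x) + √((1 - α x) * (1 - β x)))
      = ∑ a : F → Bool, ∏ x : F, √(bernoulliWeight (α x) (a x) * bernoulliWeight (β x) (a x)) := by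
    rw [← Finset.prod_coe_sort, ← Fintype.piFinset_univ,
      ← Finset.prod_univ_sum (fun _ : F => Finset.univ)
        fun x b => √(bernoulliWeight (α x) b * bernoulliWeight (β x) b)]
    simp [bernoulliWeight]
  rw [← sum_measure_preimage_singleton A fun a _ => hm (measurableSet_singleton a), hexp,
    Finset.sum_congr rfl fun a _ => h.measure_restrict_preimage_singleton hα0 hα1 F a,
    ← ENNReal.ofReal_sum_of_nonneg fun a _ => Finset.prod_nonneg fun (x : F) _ => wα x (a x)]
  refine ENNReal.ofReal_le_ofReal ((Finset.sum_le_sum fun a ha => ?_).trans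
    (Finset.sum_le_sum_of_subset_of_nonneg (Finset.subset_univ A)
      fun a _ _ => Finset.prod_nonneg fun x _ => Real.sqrt_nonneg _))
  have hp : 0 ≤ ∏ x : F, bernoulliWeight (α x) (a x) := Finset.prod_nonneg fun x _ => wα x _
  rw [← Real.sqrt_prod _ fun (x : F) _ => mul_nonneg (wα x (a x)) (wβ x (a x)),
    Finset.prod_mul_distrib]
  exact Real.le_sqrt_of_sq_le (by rw [sq]; exact mul_le_mul_of_nonneg_left (hA a ha) hp)

/-- The singular half of Kakutani's dichotomy for Bernoulli products. -/
theorem mutuallySingular (hμ : IsBernoulliProduct μ α) (hν : IsBernoulliProduct ν β)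
    (hα0 : ∀ x, 0 ≤ α x) (hα1 : ∀ x, α x ≤ 1) (hβ0 : ∀ x, 0 ≤ β x) (hβ1 : ∀ x, β x ≤ 1)
    {t : S → ℝ} (ht0 : ∀ x, 0 ≤ t x) (ht : ¬ Summable t)
    (hle : ∀ x, √(α x * β x) + √((1 - α x) * (1 - β x)) ≤ Real.exp (-t x)) :
    Measure.MutuallySingular μ ν := by
  classical
  refine Measure.mutuallySingular_of_disjoint fun ρ hρμ hρν => ?_
  have hbound (M : ℝ) : ρ Set.univ ≤ ENNReal.ofReal (2 * Real.exp (-M)) := by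
    obtain ⟨F, hF⟩ : ∃ F : Finset S, M < ∑ x ∈ F, t x := by
      by_contra! hM
      exact ht (summable_of_sum_le ht0 hM)
    have haff : ∏ x ∈ F, (√(α x * β x) + √((1 - α x) * (1 - β x))) ≤ Real.exp (-M) :=
      calc _ ≤ ∏ x ∈ F, Real.exp (-t x) :=
            Finset.prod_le_prod (fun x _ => by positivity) fun x _ => hle x
        _ = Real.exp (-∑ x ∈ F, t x) := by rw [← Real.exp_sum, Finset.sum_neg_distrib]
        _ ≤ _ := Real.exp_le_exp.2 (by linarith)
    let A : Finset (F → Bool) := {a | ∏ x : F, bernoulliWeight (α x) (a x) ≤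
      ∏ x : F, bernoulliWeight (β x) (a x)}
    have h₁ := hμ.measure_restrict_preimage_le hα0 hα1 hβ0 hβ1 F A
      fun a ha => (Finset.mem_filter.1 ha).2
    have h₂ := hν.measure_restrict_preimage_le hβ0 hβ1 hα0 hα1 F Aᶜ fun a ha => by
      simp only [A, Finset.mem_compl, Finset.mem_filter, Finset.mem_univ, true_and, not_le] at ha
      exact ha.le
    simp only [mul_comm (β _), mul_comm (1 - β _)] at h₂
    rw [Finset.coe_compl, Set.preimage_compl] at h₂
    calc ρ Set.univ ≤ ρ (F.restrict ⁻¹' A) + ρ (F.restrict ⁻¹' A)ᶜ := by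
          rw [← Set.union_compl_self (F.restrict ⁻¹' (A : Set (F → Bool)))]
          exact measure_union_le _ _
      _ ≤ ENNReal.ofReal (Real.exp (-M)) + ENNReal.ofReal (Real.exp (-M)) :=
          add_le_add ((hρμ _).trans (h₁.trans (ENNReal.ofReal_le_ofReal haff)))
            ((hρν _).trans (h₂.trans (ENNReal.ofReal_le_ofReal haff)))
      _ = _ := by rw [← ENNReal.ofReal_add (by positivity) (by positivity), two_mul]
  have hlim : Tendsto (fun M : ℝ => ENNReal.ofReal (2 * Real.exp (-M))) atTop (𝓝 0) := by
    simpa using ENNReal.tendsto_ofReal (Real.tendsto_exp_neg_atTop_nhds_zero.const_mul 2)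
  exact (Measure.measure_univ_eq_zero.1
    (le_antisymm (ge_of_tendsto' hlim hbound) zero_le)).le

/-- A configuration with summable logarithmic weights is an atom. -/
lemma measure_singleton_pos [Countable S] (h : IsBernoulliProduct μ α) (a : S → Bool) {t : S → ℝ}
    (ht0 : ∀ x, 0 ≤ t x) (ht : Summable t)
    (hle : ∀ x, Real.exp (-t x) ≤ bernoulliWeight (α x) (a x)) : 0 < μ {a} := by
  have := h.1
  have hset : ({a} : Set (S → Bool)) = ⋂ F : Finset S, {η | ∀ x ∈ F, η x = a x} := by
    ext η
    simp only [Set.mem_singleton_iff, Set.mem_iInter, Set.mem_ofPred_eq, funext_iff]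
    exact ⟨fun h F x _ => h x, fun h x => h {x} x (Finset.mem_singleton_self x)⟩
  have hdir : Directed (· ⊇ ·) fun F : Finset S => {η : S → Bool | ∀ x ∈ F, η x = a x} :=
    directed_of_isDirected_le fun F G hFG η hη x hx => hη x (Finset.mem_of_subset hFG hx)
  rw [hset, hdir.measure_iInter (fun F => (measurableSet_forall_mem_eq F a).nullMeasurableSet)
    ⟨∅, measure_ne_top _ _⟩]
  refine (ENNReal.ofReal_pos.2 (Real.exp_pos (-∑' x, t x))).trans_le (le_iInf fun F => ?_)
  rw [h.2 F a]
  change _ ≤ ∏ x ∈ F, ENNReal.ofReal (bernoulliWeight (α x) (a x))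
  rw [← ENNReal.ofReal_prod_of_nonneg fun x _ => (Real.exp_pos _).le.trans (hle x)]
  refine ENNReal.ofReal_le_ofReal ?_
  calc Real.exp (-∑' x, t x) ≤ Real.exp (-∑ x ∈ F, t x) :=
        Real.exp_le_exp.2 (neg_le_neg (ht.sum_le_tsum F fun x _ => ht0 x))
    _ = ∏ x ∈ F, Real.exp (-t x) := by rw [← Real.exp_sum, Finset.sum_neg_distrib]
    _ ≤ _ := Finset.prod_le_prod (fun x _ => (Real.exp_pos _).le) fun x _ => hle x

lemma dirac (a : S → Bool) :
    IsBernoulliProduct (Measure.dirac a) (fun x => if a x then 1 else 0) := by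
  classical
  refine ⟨inferInstance, fun F b => ?_⟩
  rw [Measure.dirac_apply' _ (measurableSet_forall_mem_eq F b)]
  by_cases h : ∀ x ∈ F, a x = b x
  · rw [Set.indicator_of_mem (by exact h), Finset.prod_eq_one fun x hx => ?_]
    · rfl
    · cases hb : b x <;> simp [h x hx, hb]
  · rw [Set.indicator_of_notMem (by exact h)]
    push Not at h
    obtain ⟨x, hx, hne⟩ := h
    refine (Finset.prod_eq_zero hx ?_).symm
    cases ha : a x <;> cases hb : b x <;> simp_all

end IsBernoulliProduct

lemma le_exp_neg_of_sq_le {h t : ℝ} (hsq : h ^ 2 ≤ 1 - 2 * t) : h ≤ Real.exp (-t) := by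
  refine le_of_sq_le_sq ?_ (Real.exp_pos _).le
  rw [← Real.exp_nat_mul]
  have := Real.add_one_le_exp (((2 : ℕ) : ℝ) * -t)
  push_cast at this ⊢
  linarith

/-- Hellinger affinity of the Bernoulli laws with odds `s ^ 2 * p` and `u ^ 2 * p`. -/
lemma affinity_le_exp {s u p : ℝ} (hs : 0 ≤ s) (hu : 0 ≤ u) (hp : 0 < p) :
    √(s ^ 2 * p / (1 + s ^ 2 * p) * (u ^ 2 * p / (1 + u ^ 2 * p))) +
      √((1 - s ^ 2 * p / (1 + s ^ 2 * p)) * (1 - u ^ 2 * p / (1 + u ^ 2 * p))) ≤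
      Real.exp (-((s - u) ^ 2 / (2 * ((1 + s ^ 2) * (1 + u ^ 2))) * (p / (1 + p) ^ 2))) := by
  apply le_exp_neg_of_sq_le
  have hA : 0 < 1 + s ^ 2 * p := by positivity
  have hB : 0 < 1 + u ^ 2 * p := by positivity
  have e₁ : s ^ 2 * p / (1 + s ^ 2 * p) * (u ^ 2 * p / (1 + u ^ 2 * p)) =
      (s * u * p) ^ 2 / ((1 + s ^ 2 * p) * (1 + u ^ 2 * p)) := by field_simp
  have e₂ : (1 - s ^ 2 * p / (1 + s ^ 2 * p)) * (1 - u ^ 2 * p / (1 + u ^ 2 * p)) =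
      1 / ((1 + s ^ 2 * p) * (1 + u ^ 2 * p)) := by field_simp; ring
  rw [e₁, e₂, Real.sqrt_div (sq_nonneg _), Real.sqrt_div zero_le_one,
    Real.sqrt_sq (by positivity), Real.sqrt_one, ← add_div, div_pow,
    Real.sq_sqrt (by positivity)]
  have e₃ : (s * u * p + 1) ^ 2 / ((1 + s ^ 2 * p) * (1 + u ^ 2 * p)) =
      1 - (s - u) ^ 2 * p / ((1 + s ^ 2 * p) * (1 + u ^ 2 * p)) := by field_simp; ring
  have e₄ : 2 * ((s - u) ^ 2 / (2 * ((1 + s ^ 2) * (1 + u ^ 2))) * (p / (1 + p) ^ 2)) =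
      (s - u) ^ 2 * p / (((1 + s ^ 2) * (1 + p)) * ((1 + u ^ 2) * (1 + p))) := by
    field_simp
  rw [e₃, e₄]
  have := sq_nonneg s
  have := sq_nonneg u
  gcongr <;> nlinarith

/-- Hellinger affinity of the Bernoulli law with odds `r * p` and the point mass at `1`. -/
lemma affinity_one_le_exp {r p : ℝ} (hr : 0 ≤ r) (hp : 0 < p) :
    √(r * p / (1 + r * p) * 1) + √((1 - r * p / (1 + r * p)) * (1 - 1)) ≤
      Real.exp (-(1 / (2 * (1 + r)) * (p / (1 + p) ^ 2))) := by
  apply le_exp_neg_of_sq_le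
  have hA : 0 < 1 + r * p := by positivity
  rw [sub_self, mul_zero, Real.sqrt_zero, add_zero, mul_one, Real.sq_sqrt (by positivity)]
  have e₁ : r * p / (1 + r * p) = 1 - 1 / (1 + r * p) := by field_simp; ring
  have e₂ : 2 * (1 / (2 * (1 + r)) * (p / (1 + p) ^ 2)) = p / ((1 + r) * (1 + p) ^ 2) := by
    field_simp
  rw [e₁, e₂]
  refine sub_le_sub_left ?_ _
  rw [div_le_div_iff₀ (by positivity) hA]
  nlinarith [mul_nonneg hr hp.le, mul_nonneg hr (sq_nonneg p)]

/-- Under odds `r * p` with `r ≥ 1`, the value that is likelier under odds `p` has logarithmic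
weight of order at most `p / (1 + p) ^ 2`. -/
lemma exp_le_bernoulliWeight {r p : ℝ} (hr : 1 ≤ r) (hp : 0 < p) :
    Real.exp (-(4 * r * (p / (1 + p) ^ 2))) ≤
      bernoulliWeight (r * p / (1 + r * p)) (decide (1 ≤ p)) := by
  have inv_one_add (y z : ℝ) (hy : 0 ≤ y) (hyz : y ≤ z) : Real.exp (-z) ≤ 1 / (1 + y) := by
    rw [Real.exp_neg, ← one_div]
    refine one_div_le_one_div_of_le (by positivity) ?_
    linarith [Real.add_one_le_exp z]
  have hr0 : 0 < r := by linarith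
  unfold bernoulliWeight
  by_cases h : 1 ≤ p
  · have e : r * p / (1 + r * p) = 1 / (1 + 1 / (r * p)) := by field_simp; ring
    simp only [h, decide_true, if_true, e]
    refine inv_one_add _ _ (by positivity) ?_
    rw [← mul_div_assoc, div_le_div_iff₀ (by positivity) (by positivity)]
    have : 1 * (1 + p) ^ 2 ≤ r ^ 2 * (2 * p) ^ 2 := by
      gcongr
      · nlinarith
      · linarith
    linarith
  · push Not at h
    have e : 1 - r * p / (1 + r * p) = 1 / (1 + r * p) := by field_simp; ring
    simp only [not_le.2 h, decide_false, Bool.false_eq_true, if_false, e]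
    refine inv_one_add _ _ (by positivity) ?_
    rw [← mul_div_assoc, le_div_iff₀ (by positivity)]
    have : (1 + p) ^ 2 ≤ 4 := by nlinarith
    nlinarith [mul_pos hr0 hp]

/-- (Kakutani dichotomy.) `∑ₓ π(x)/(1+π(x))² = ∞` iff the measures
`{ν^c : 0 ≤ c ≤ ∞}` are pairwise mutually singular. -/
theorem not_summable_iff_pairwise_mutually_singular {S : Type*} [Countable S]
    (π : S → ℝ) (hπ : ∀ x, 0 < π x)
    (ν : ENNReal → Measure (S → Bool))
    (hν0 : ν 0 = Measure.dirac (fun _ : S => false))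
    (hνtop : ν ⊤ = Measure.dirac (fun _ : S => true))
    (hν : ∀ c : ENNReal, 0 < c → c < ⊤ →
      IsBernoulliProduct (ν c) (fun x => c.toReal * π x / (1 + c.toReal * π x))) :
    ¬ Summable (fun x => π x / (1 + π x) ^ 2) ↔
      ∀ c c' : ENNReal, c ≠ c' → Measure.MutuallySingular (ν c) (ν c') := by
  have hq0 (x) : 0 ≤ π x / (1 + π x) ^ 2 := by have := hπ x; positivity
  have hα0 (r : ℝ) (hr : 0 ≤ r) (x) : 0 ≤ r * π x / (1 + r * π x) := by
    have := hπ x; positivity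
  have hα1 (r : ℝ) (hr : 0 ≤ r) (x) : r * π x / (1 + r * π x) ≤ 1 := by
    have := hπ x
    exact div_le_one_of_le₀ (by linarith) (by positivity)
  have hfin (c : ENNReal) (hc : c ≠ ⊤) :
      IsBernoulliProduct (ν c) (fun x => c.toReal * π x / (1 + c.toReal * π x)) := by
    rcases eq_or_ne c 0 with rfl | h0
    · simpa [hν0] using IsBernoulliProduct.dirac (fun _ : S => false)
    · exact hν c (pos_iff_ne_zero.2 h0) hc.lt_top
  have htop : IsBernoulliProduct (ν ⊤) (fun _ => 1) := by
    simpa [hνtop] using IsBernoulliProduct.dirac (fun _ : S => true)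
  constructor
  · intro hns
    have hns' {δ : ℝ} (hδ : 0 < δ) : ¬ Summable fun x => δ * (π x / (1 + π x) ^ 2) :=
      fun h => hns ((summable_mul_left_iff hδ.ne').1 h)
    have sing_top (c : ENNReal) (hc : c ≠ ⊤) : Measure.MutuallySingular (ν c) (ν ⊤) := by
      have hr : 0 ≤ c.toReal := ENNReal.toReal_nonneg
      have hδ : 0 < 1 / (2 * (1 + c.toReal)) := by positivity
      exact (hfin c hc).mutuallySingular htop (hα0 _ hr) (hα1 _ hr) (fun _ => zero_le_one)
        (fun _ => le_rfl) (fun x => mul_nonneg hδ.le (hq0 x)) (hns' hδ)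
        fun x => affinity_one_le_exp hr (hπ x)
    intro c c' hne
    rcases eq_or_ne c ⊤ with rfl | hc
    · exact (sing_top c' hne.symm).symm
    rcases eq_or_ne c' ⊤ with rfl | hc'
    · exact sing_top c hc
    have hr : 0 ≤ c.toReal := ENNReal.toReal_nonneg
    have hr' : 0 ≤ c'.toReal := ENNReal.toReal_nonneg
    have hsub : √c.toReal - √c'.toReal ≠ 0 := by
      rw [sub_ne_zero, Ne, Real.sqrt_inj hr hr', ENNReal.toReal_eq_toReal_iff' hc hc']
      exact hne
    have hδ : 0 < (√c.toReal - √c'.toReal) ^ 2 /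
        (2 * ((1 + √c.toReal ^ 2) * (1 + √c'.toReal ^ 2))) := by positivity
    refine (hfin c hc).mutuallySingular (hfin c' hc') (hα0 _ hr) (hα1 _ hr) (hα0 _ hr')
      (hα1 _ hr') (fun x => mul_nonneg hδ.le (hq0 x)) (hns' hδ) fun x => ?_
    have := affinity_le_exp (Real.sqrt_nonneg c.toReal) (Real.sqrt_nonneg c'.toReal) (hπ x)
    simpa only [Real.sq_sqrt hr, Real.sq_sqrt hr'] using this
  · intro hsing hs
    have atom (c : ENNReal) (hc : c ≠ ⊤) (h1 : 1 ≤ c.toReal) :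
        0 < ν c {fun x => decide (1 ≤ π x)} :=
      (hfin c hc).measure_singleton_pos _
        (fun x => mul_nonneg (by linarith) (hq0 x)) (hs.mul_left (4 * c.toReal))
        fun x => exp_le_bernoulliWeight h1 (hπ x)
    obtain ⟨E, -, h₁, h₂⟩ := hsing 1 2 (by norm_num)
    by_cases hE : (fun x => decide (1 ≤ π x)) ∈ E
    · exact (atom 1 (by simp) (by simp)).ne'
        (measure_mono_null (Set.singleton_subset_iff.2 hE) h₁)
    · exact (atom 2 (by simp) (by simp)).ne'
        (measure_mono_null (Set.singleton_subset_iff.2 hE) h₂)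
end

section
/- Let S be a countable set and let α, β : S → (0,1) satisfy ∑_{x∈S} |α(x) − β(x)| < ∞. Then the infinite product ∏_{x∈S} [ (α(x)β(x))^{1/2} + ((1−α(x))(1−β(x)))^{1/2} ] converges to a strictly positive value; in fact it is bounded below by ∏_{x∈S} (1 − |α(x) − β(x)|) > 0. -/
open MeasureTheory Filter Topology

theorem one_sub_abs_sub_le_sqrt_add_sqrt {a b : ℝ} (ha : 0 ≤ a ∧ a ≤ 1) (hb : 0 ≤ b ∧ b ≤ 1) :
    1 - |a - b| ≤ √(a * b) + √((1 - a) * (1 - b)) := by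
  wlog hab : a ≤ b generalizing a b
  · simpa only [abs_sub_comm, mul_comm] using this hb ha (le_of_not_ge hab)
  have h₁ : a ≤ √(a * b) := Real.le_sqrt_of_sq_le (by nlinarith)
  have h₂ : 1 - b ≤ √((1 - a) * (1 - b)) := Real.le_sqrt_of_sq_le (by nlinarith)
  rw [abs_of_nonpos (by linarith)]
  linarith

theorem sqrt_add_sqrt_le_one {a b : ℝ} (ha : 0 ≤ a ∧ a ≤ 1) (hb : 0 ≤ b ∧ b ≤ 1) :
    √(a * b) + √((1 - a) * (1 - b)) ≤ 1 := by
  have h₁ : √(a * b) ≤ (a + b) / 2 :=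
    Real.sqrt_le_iff.2 ⟨by linarith, by nlinarith [sq_nonneg (a - b)]⟩
  have h₂ : √((1 - a) * (1 - b)) ≤ ((1 - a) + (1 - b)) / 2 :=
    Real.sqrt_le_iff.2 ⟨by linarith, by nlinarith [sq_nonneg (a - b)]⟩
  linarith

theorem tprod_one_sub_pos {ι : Type*} {f : ι → ℝ} (hf : Summable f) (h : ∀ i, f i < 1) :
    0 < ∏' i, (1 - f i) := by
  have hlog := Real.summable_log_one_add_of_summable hf.neg
  simp only [← sub_eq_add_neg] at hlog
  rw [← Real.rexp_tsum_eq_tprod (fun i => sub_pos.2 (h i)) hlog]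
  exact Real.exp_pos _

/-- If `∑ₓ |α(x) - β(x)| < ∞`, then the infinite product
`∏ₓ (√(α(x)β(x)) + √((1-α(x))(1-β(x))))` converges to a strictly positive value; in fact it
is bounded below by `∏ₓ (1 - |α(x) - β(x)|) > 0`. -/
theorem hellinger_product_positive {S : Type*} [Countable S]
    (α β : S → ℝ) (hα : ∀ x, 0 < α x ∧ α x < 1) (hβ : ∀ x, 0 < β x ∧ β x < 1)
    (hsum : Summable (fun x => |α x - β x|)) :
    Multipliable (fun x => Real.sqrt (α x * β x) + Real.sqrt ((1 - α x) * (1 - β x))) ∧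
    Multipliable (fun x => 1 - |α x - β x|) ∧
    0 < ∏' x, (1 - |α x - β x|) ∧
    (∏' x, (1 - |α x - β x|)) ≤
      ∏' x, (Real.sqrt (α x * β x) + Real.sqrt ((1 - α x) * (1 - β x))) ∧
    0 < ∏' x, (Real.sqrt (α x * β x) + Real.sqrt ((1 - α x) * (1 - β x))) := by
  have hα' x : 0 ≤ α x ∧ α x ≤ 1 := ⟨(hα x).1.le, (hα x).2.le⟩
  have hβ' x : 0 ≤ β x ∧ β x ≤ 1 := ⟨(hβ x).1.le, (hβ x).2.le⟩
  have hlt x : |α x - β x| < 1 := by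
    rw [abs_lt]
    constructor <;> linarith [(hα x).1, (hα x).2, (hβ x).1, (hβ x).2]
  have hlow x := one_sub_abs_sub_le_sqrt_add_sqrt (hα' x) (hβ' x)
  have hup x := sqrt_add_sqrt_le_one (hα' x) (hβ' x)
  have hmul : Multipliable (fun x => 1 - |α x - β x|) := by
    simpa only [← sub_eq_add_neg] using Real.multipliable_one_add_of_summable hsum.neg
  have hmul' :
      Multipliable (fun x => Real.sqrt (α x * β x) + Real.sqrt ((1 - α x) * (1 - β x))) := by
    have hs : Summable
        (fun x => Real.sqrt (α x * β x) + Real.sqrt ((1 - α x) * (1 - β x)) - 1) :=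
      hsum.of_norm_bounded fun x => by
        rw [Real.norm_eq_abs, abs_of_nonpos (by linarith [hup x])]
        linarith [hlow x]
    simpa only [add_sub_cancel] using Real.multipliable_one_add_of_summable hs
  have hpos := tprod_one_sub_pos hsum hlt
  have hle := le_of_tendsto_of_tendsto' hmul.hasProd hmul'.hasProd fun s =>
    Finset.prod_le_prod (fun x _ => sub_nonneg.2 (hlt x).le) fun x _ => hlow x
  exact ⟨hmul', hmul, hpos, hle, hpos.trans_le hle⟩
end

section
/- Let S be a countably infinite set, π : S → (0,∞) with ∑_{x∈S} π(x)/(1+π(x))² = ∞, and let 0 < c < ∞ and ε > 0. Set α(x) = cπ(x)/(1+cπ(x)) and β(x) = (c+ε)π(x)/(1+(c+ε)π(x)). Then: (i) β(x) − α(x) > ε π(x)/(1+(c+ε)π(x))² for every x ∈ S; and (ii) if ω is the product probability measure on ({0,1}×{0,1})^S whose x-th factor assigns mass α(x) to (1,1), mass β(x) − α(x) to (0,1), and mass 1 − β(x) to (0,0), then ω-almost surely the set {x ∈ S : the first coordinate at x equals 0 and the second coordinate at x equals 1} is infinite. -/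
open MeasureTheory Filter Topology

/-- `ω` is the product measure on `({0,1} × {0,1})^S` with factor distributions `m x`. -/
def IsPairProduct {S : Type*} (ω : Measure (S → Bool × Bool)) (m : S → Bool × Bool → ℝ) : Prop :=
  IsProbabilityMeasure ω ∧ ∀ (F : Finset S) (a : S → Bool × Bool),
    ω {η | ∀ x ∈ F, η x = a x} = ∏ x ∈ F, ENNReal.ofReal (m x (a x))

open ProbabilityTheory in
/-- Second Borel–Cantelli lemma for events indexed by a countably infinite type. -/
theorem measure_infinite_eq_one_of_iIndepSet {ι Ω : Type*} [Countable ι] [Infinite ι]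
    [MeasurableSpace Ω] {μ : Measure Ω} {s : ι → Set Ω} (hsm : ∀ i, MeasurableSet (s i))
    (hs : iIndepSet s μ) (hsum : ∑' i, μ (s i) = ⊤) :
    μ {w | {i | w ∈ s i}.Infinite} = 1 := by
  obtain ⟨e⟩ := nonempty_equiv_of_countable (α := ℕ) (β := ι)
  have h := measure_limsup_eq_one (fun n => hsm (e n)) (hs.precomp e.injective)
    ((e.tsum_eq fun i => μ (s i)).trans hsum)
  rw [← h]
  congr 1
  ext w
  rw [mem_limsup_iff_frequently_mem, Nat.frequently_atTop_iff_infinite]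
  refine not_congr ⟨fun h => h.preimage e.injective.injOn, fun h => ?_⟩
  exact .of_preimage h e.surjective

/-- The one-site marginals of a product measure. -/
theorem IsPairProduct.measure_eq {S : Type*} {ω : Measure (S → Bool × Bool)}
    {m : S → Bool × Bool → ℝ} (h : IsPairProduct ω m) (x : S) (b : Bool × Bool) :
    ω {η | η x = b} = ENNReal.ofReal (m x b) := by
  simpa using h.2 {x} fun _ => b

open ProbabilityTheory in
/-- Under a product measure, the events `η x = b` for a fixed value `b` are independent. -/
theorem IsPairProduct.iIndepSet_eq {S : Type*} {ω : Measure (S → Bool × Bool)}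
    {m : S → Bool × Bool → ℝ} (h : IsPairProduct ω m) (b : Bool × Bool) :
    iIndepSet (fun x => {η : S → Bool × Bool | η x = b}) ω := by
  have hm (x : S) : MeasurableSet {η : S → Bool × Bool | η x = b} :=
    measurableSet_eq_fun (measurable_pi_apply x) measurable_const
  rw [iIndepSet_iff_meas_biInter hm]
  intro F
  have hF := h.2 F fun _ => b
  simp_rw [h.measure_eq, ← hF]
  congr 1
  ext η
  simp

theorem tsum_ofReal_eq_top_of_not_summable {ι : Type*} {f : ι → ℝ} (hf : ∀ i, 0 ≤ f i)
    (h : ¬ Summable f) : ∑' i, ENNReal.ofReal (f i) = ⊤ := by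
  by_contra hne
  refine h ((ENNReal.summable_toReal hne).congr fun i => ?_)
  rw [ENNReal.toReal_ofReal (hf i)]

/-- A strict lower bound for the gap between the densities
`c p / (1 + c p)` and `(c + ε) p / (1 + (c + ε) p)`. -/
theorem density_gap_lt {p c ε : ℝ} (hp : 0 < p) (hc : 0 < c) (hε : 0 < ε) :
    ε * p / (1 + (c + ε) * p) ^ 2 < (c + ε) * p / (1 + (c + ε) * p) - c * p / (1 + c * p) := by
  have h : (c + ε) * p / (1 + (c + ε) * p) - c * p / (1 + c * p) =
      ε * p / ((1 + (c + ε) * p) * (1 + c * p)) := by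
    field_simp
    ring
  rw [h, sq]
  have : 0 < ε * p := by positivity
  gcongr
  linarith

/-- Divergence of `∑ π / (1 + π)²` forces divergence of `∑ ε π / (1 + b π)²`. -/
theorem not_summable_scaled_density {S : Type*} {π : S → ℝ} (hπ : ∀ x, 0 < π x)
    (hdiv : ¬ Summable fun x => π x / (1 + π x) ^ 2) {b ε : ℝ} (hb : 0 < b) (hε : 0 < ε) :
    ¬ Summable fun x => ε * π x / (1 + b * π x) ^ 2 := by
  intro h
  refine hdiv (.of_nonneg_of_le (fun x => ?_) (fun x => ?_) (h.mul_left ((1 + b) ^ 2 / ε)))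
  · have := hπ x
    positivity
  · have hx := hπ x
    have hle : 1 + b * π x ≤ (1 + b) * (1 + π x) := by nlinarith
    calc π x / (1 + π x) ^ 2 = (1 + b) ^ 2 * π x / ((1 + b) * (1 + π x)) ^ 2 := by field_simp
      _ ≤ (1 + b) ^ 2 * π x / (1 + b * π x) ^ 2 := by gcongr
      _ = (1 + b) ^ 2 / ε * (ε * π x / (1 + b * π x) ^ 2) := by field_simp

/-- With `α(x) = cπ(x)/(1+cπ(x))` and `β(x) = (c+ε)π(x)/(1+(c+ε)π(x))`:
(i) `β(x) - α(x) > ε π(x)/(1+(c+ε)π(x))²`; (ii) under the monotone product coupling `ω`,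
almost surely there are infinitely many sites where the first coordinate is `0` and the
second is `1`. -/
theorem coupling_infinitely_many_discrepancies {S : Type*} [Countable S] [Infinite S]
    (π : S → ℝ) (hπ : ∀ x, 0 < π x)
    (hdiv : ¬ Summable (fun x => π x / (1 + π x) ^ 2))
    (c ε : ℝ) (hc : 0 < c) (hε : 0 < ε) :
    (∀ x : S, ε * π x / (1 + (c + ε) * π x) ^ 2 <
      (c + ε) * π x / (1 + (c + ε) * π x) - c * π x / (1 + c * π x)) ∧
    (∀ ω : Measure (S → Bool × Bool),
      IsPairProduct ω (fun x pr =>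
        if pr = (true, true) then c * π x / (1 + c * π x)
        else if pr = (false, true) then
          (c + ε) * π x / (1 + (c + ε) * π x) - c * π x / (1 + c * π x)
        else if pr = (false, false) then 1 - (c + ε) * π x / (1 + (c + ε) * π x)
        else 0) →
      ω {η | {x : S | (η x).1 = false ∧ (η x).2 = true}.Infinite} = 1) := by
  have hgap (x : S) := density_gap_lt (hπ x) hc hε
  refine ⟨hgap, fun ω hω => ?_⟩
  have hpos (x : S) : 0 ≤ ε * π x / (1 + (c + ε) * π x) ^ 2 := by
    have := hπ x
    positivity
  have hsum : ∑' x, ω {η | η x = (false, true)} = ⊤ := by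
    refine top_unique ?_
    rw [← tsum_ofReal_eq_top_of_not_summable hpos
      (not_summable_scaled_density hπ hdiv (add_pos hc hε) hε)]
    refine ENNReal.tsum_le_tsum fun x => ?_
    have hx := hω.measure_eq x (false, true)
    simp only [Prod.mk.injEq, Bool.false_eq_true, false_and, if_true, if_false] at hx
    rw [hx]
    exact ENNReal.ofReal_le_ofReal (hgap x).le
  simpa [Prod.ext_iff] using measure_infinite_eq_one_of_iIndepSet
    (fun x => measurableSet_eq_fun (measurable_pi_apply x) measurable_const)
    (hω.iIndepSet_eq (false, true)) hsum
end
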